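/- arXiv:2406.00274 — 2 statements merged into one kernel-verified Lean document; each statement's English description precedes it below -/
import Mathlib

section
/- For all π̄, π̄' ∈ E₁ and p̄ ∈ E₂: ‖π(π̄',p̄) − π(π̄,p̄)‖ ≤ κ₂‖π̄−π̄'‖ and ‖p(π̄,p̄) − p(π̄',p̄)‖ ≤ κ₃‖π̄−π̄'‖. -/
open scoped RealInnerProductSpace

/-- The regularized function `χ(π,p,π̄,p̄) = f(π,p) + (r₁/2)‖π−π̄‖² − (r₂/2)‖p−p̄‖²`. -/
noncomputable def chi {E₁ E₂ : Type*} [NormedAddCommGroup E₁] [NormedAddCommGroup E₂]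
    (f : E₁ → E₂ → ℝ) (r₁ r₂ : ℝ) (π : E₁) (p : E₂) (πb : E₁) (pb : E₂) : ℝ :=
  f π p + r₁ / 2 * ‖π - πb‖ ^ 2 - r₂ / 2 * ‖p - pb‖ ^ 2

lemma aux_quad {E : Type*} [NormedAddCommGroup E] [InnerProductSpace ℝ E] (x y a : E) (t : ℝ) :
    ‖x + t • (y - x) - a‖ ^ 2 =
      (1 - t) * ‖x - a‖ ^ 2 + t * ‖y - a‖ ^ 2 - t * (1 - t) * ‖y - x‖ ^ 2 := by
  have e1 : x + t • (y - x) - a = (x - a) + t • (y - x) := by abel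
  have e2 : y - a = (x - a) + (y - x) := by abel
  rw [e1, e2, norm_add_sq_real, norm_add_sq_real, inner_smul_right, norm_smul, mul_pow,
    Real.norm_eq_abs, sq_abs]
  ring

lemma aux_weak {E : Type*} [NormedAddCommGroup E] [InnerProductSpace ℝ E] [CompleteSpace E]
    (S : Set E) (hS : Convex ℝ S) (h : E → ℝ) (g : E → E)
    (hg : ∀ x, HasGradientAt h (g x) x) (l : ℝ)
    (hl : ∀ x ∈ S, ∀ y ∈ S, ‖g x - g y‖ ≤ l * ‖x - y‖)
    (x y : E) (hx : x ∈ S) (hy : y ∈ S) (t : ℝ) (ht : t ∈ Set.Icc (0 : ℝ) 1) :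
    h (x + t • (y - x)) ≤ (1 - t) * h x + t * h y + l / 2 * (t * (1 - t)) * ‖y - x‖ ^ 2 := by
  set ψ : ℝ → ℝ := fun s => h (x + s • (y - x)) + l / 2 * s ^ 2 * ‖y - x‖ ^ 2 with hψ
  have hd : ∀ s, HasDerivAt ψ (inner ℝ (g (x + s • (y - x))) (y - x) + l * s * ‖y - x‖ ^ 2) s := by
    intro s
    have h1 : HasDerivAt (fun s : ℝ => x + s • (y - x)) (y - x) s := by
      simpa using ((hasDerivAt_id s).smul_const (y - x)).const_add x
    have h2 := ((hg (x + s • (y - x))).hasFDerivAt).comp_hasDerivAt s h1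
    have h3 : HasDerivAt (fun s : ℝ => l / 2 * s ^ 2 * ‖y - x‖ ^ 2) (l * s * ‖y - x‖ ^ 2) s := by
      have := (((hasDerivAt_pow 2 s).const_mul (l / 2)).mul_const (‖y - x‖ ^ 2))
      refine this.congr_deriv ?_
      push_cast
      ring
    have h4 := h2.add h3
    rw [InnerProductSpace.toDual_apply_apply] at h4
    exact h4
  have hmem : ∀ s ∈ Set.Icc (0 : ℝ) 1, x + s • (y - x) ∈ S := fun s hs =>
    hS.add_smul_sub_mem hx hy hs
  have hconv : ConvexOn ℝ (Set.Icc (0 : ℝ) 1) ψ := by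
    apply MonotoneOn.convexOn_of_deriv (convex_Icc 0 1)
    · exact fun s _ => (hd s).continuousAt.continuousWithinAt
    · exact fun s _ => (hd s).differentiableAt.differentiableWithinAt
    · rw [interior_Icc]
      intro s hs u hu hsu
      rw [(hd s).deriv, (hd u).deriv]
      have b1 := hl _ (hmem s ⟨hs.1.le, hs.2.le⟩) _ (hmem u ⟨hu.1.le, hu.2.le⟩)
      have e : x + s • (y - x) - (x + u • (y - x)) = (s - u) • (y - x) := by
        rw [sub_smul]; abel
      rw [e, norm_smul, Real.norm_eq_abs, abs_of_nonpos (by linarith)] at b1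
      have b2 := real_inner_le_norm (g (x + s • (y - x)) - g (x + u • (y - x))) (y - x)
      rw [inner_sub_left] at b2
      have b3 := mul_le_mul_of_nonneg_right b1 (norm_nonneg (y - x))
      nlinarith
  have := hconv.2 (Set.left_mem_Icc.2 zero_le_one) (Set.right_mem_Icc.2 zero_le_one)
    (sub_nonneg.2 ht.2) ht.1 (by ring)
  simp [hψ] at this
  linarith

lemma aux_strong_min {E : Type*} [NormedAddCommGroup E] [InnerProductSpace ℝ E]
    (S : Set E) (hS : Convex ℝ S) (G : E → ℝ) (c : ℝ) (x y : E) (hx : x ∈ S) (hy : y ∈ S)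
    (hmin : ∀ z ∈ S, G x ≤ G z)
    (hc : ∀ t ∈ Set.Icc (0 : ℝ) 1, G (x + t • (y - x)) ≤ (1 - t) * G x + t * G y - c * (t * (1 - t))) :
    G x + c ≤ G y := by
  by_contra! hlt
  have h0 := hmin y hy
  have hcpos : 0 < c := by linarith
  set t := (c - (G y - G x)) / (2 * c) with htd
  have htc : t * (2 * c) = c - (G y - G x) := by rw [htd]; field_simp
  have ht0 : 0 < t := by apply div_pos <;> linarith
  have ht1 : t ≤ 1 := by rw [htd, div_le_one (by linarith)]; linarith
  have h1 := hc t ⟨ht0.le, ht1⟩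
  have h2 := hmin _ (hS.add_smul_sub_mem hx hy ⟨ht0.le, ht1⟩)
  have h3 : 0 ≤ t * (G y - G x - c * (1 - t)) := by nlinarith
  have h4 : 0 ≤ G y - G x - c * (1 - t) := nonneg_of_mul_nonneg_right h3 ht0
  linarith

/-- Lipschitz continuity of `π(π̄,p̄)` and `p(π̄,p̄)` in `π̄`:
`‖π(π̄',p̄) − π(π̄,p̄)‖ ≤ κ₂‖π̄−π̄'‖` and `‖p(π̄,p̄) − p(π̄',p̄)‖ ≤ κ₃‖π̄−π̄'‖`. -/
theorem minimax_selections_lipschitz_in_anchor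
    {E₁ : Type*} [NormedAddCommGroup E₁] [InnerProductSpace ℝ E₁] [FiniteDimensional ℝ E₁]
    {E₂ : Type*} [NormedAddCommGroup E₂] [InnerProductSpace ℝ E₂] [FiniteDimensional ℝ E₂]
    (P : Set E₁) (Q : Set E₂)
    (hPne : P.Nonempty) (hPcpt : IsCompact P) (hPconv : Convex ℝ P)
    (hQne : Q.Nonempty) (hQcpt : IsCompact Q) (hQconv : Convex ℝ Q)
    (f : E₁ → E₂ → ℝ) (hf : ContDiff ℝ 1 (fun q : E₁ × E₂ => f q.1 q.2))
    (gπ : E₁ → E₂ → E₁) (gp : E₁ → E₂ → E₂)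
    (hgπ : ∀ π p, HasGradientAt (fun π' => f π' p) (gπ π p) π)
    (hgp : ∀ π p, HasGradientAt (fun p' => f π p') (gp π p) p)
    (ℓ₁ ℓ₂ : ℝ) (hℓ₁ : 0 < ℓ₁) (hℓ₂ : 0 < ℓ₂)
    (hlipπ : ∀ π ∈ P, ∀ π' ∈ P, ∀ p ∈ Q, ∀ p' ∈ Q,
      ‖gπ π p - gπ π' p'‖ ≤ ℓ₁ * (‖π - π'‖ + ‖p - p'‖))
    (hlipp : ∀ π ∈ P, ∀ π' ∈ P, ∀ p ∈ Q, ∀ p' ∈ Q,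
      ‖gp π p - gp π' p'‖ ≤ ℓ₂ * (‖π - π'‖ + ‖p - p'‖))
    (r₁ r₂ : ℝ) (hr₁ : ℓ₁ < r₁) (hr₂ : (ℓ₂ / (r₁ - ℓ₁) + 2) * ℓ₂ < r₂)
    -- `πsel2 π̄ p̄` is the unique minimizer over `Π` of `π ↦ max_{p∈𝒫} χ(π,p,π̄,p̄)`
    (πsel2 : E₁ → E₂ → E₁)
    (hπsel2 : ∀ (πb : E₁) (pb : E₂), πsel2 πb pb ∈ P ∧
      ∀ π' ∈ P, sSup ((fun p => chi f r₁ r₂ (πsel2 πb pb) p πb pb) '' Q) ≤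
        sSup ((fun p => chi f r₁ r₂ π' p πb pb) '' Q))
    -- `psel2 π̄ p̄` is the unique maximizer over `𝒫` of `p ↦ χ(π(π̄,p̄),p,π̄,p̄)`
    (psel2 : E₁ → E₂ → E₂)
    (hpsel2 : ∀ (πb : E₁) (pb : E₂), psel2 πb pb ∈ Q ∧
      ∀ p' ∈ Q, chi f r₁ r₂ (πsel2 πb pb) p' πb pb ≤
        chi f r₁ r₂ (πsel2 πb pb) (psel2 πb pb) πb pb) :
    ∀ (πb πb' : E₁) (pb : E₂),
      ‖πsel2 πb' pb - πsel2 πb pb‖ ≤ r₁ / (r₁ - ℓ₁) * ‖πb - πb'‖ ∧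
      ‖psel2 πb pb - psel2 πb' pb‖ ≤
        (r₁ * (ℓ₂ / (r₁ - ℓ₁) + 1) / (r₂ - ℓ₂) +
          (r₁ / (r₁ - ℓ₁)) / (ℓ₂ / (r₁ - ℓ₁) + 1)) * ‖πb - πb'‖ := by
  intro a b pb
  obtain ⟨hx, hxm⟩ := hπsel2 a pb
  obtain ⟨hy, hym⟩ := hπsel2 b pb
  obtain ⟨hp, hpm⟩ := hpsel2 a pb
  obtain ⟨hq, hqm⟩ := hpsel2 b pb
  generalize πsel2 a pb = x at *
  generalize πsel2 b pb = y at *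
  generalize psel2 a pb = p at *
  generalize psel2 b pb = q at *
  have hμ : 0 < r₁ - ℓ₁ := by linarith
  have hk : 0 < ℓ₂ / (r₁ - ℓ₁) := div_pos hℓ₂ hμ
  have hν : 0 < r₂ - ℓ₂ := by nlinarith
  have hcont : ∀ z c, ContinuousOn (fun p => chi f r₁ r₂ z p c pb) Q := by
    intro z c
    have h1 : Continuous (fun p => f z p) :=
      continuous_iff_continuousAt.2 fun p => (hgp z p).continuousAt
    unfold chi
    exact Continuous.continuousOn (by fun_prop)
  have hbdd : ∀ z c, BddAbove ((fun p => chi f r₁ r₂ z p c pb) '' Q) := fun z c =>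
    (hQcpt.image_of_continuousOn (hcont z c)).bddAbove
  set M : E₁ → E₁ → ℝ := fun c z => sSup ((fun p => chi f r₁ r₂ z p c pb) '' Q) with hM
  have hle : ∀ c z, ∀ s ∈ Q, chi f r₁ r₂ z s c pb ≤ M c z := fun c z s hs =>
    le_csSup (hbdd z c) (Set.mem_image_of_mem _ hs)
  have hMle : ∀ c z B, (∀ s ∈ Q, chi f r₁ r₂ z s c pb ≤ B) → M c z ≤ B := by
    intro c z B hB
    apply csSup_le (hQne.image _)
    rintro _ ⟨s, hs, rfl⟩
    exact hB s hs
  have hstrong : ∀ c, ∀ u ∈ P, ∀ v ∈ P, ∀ t ∈ Set.Icc (0 : ℝ) 1,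
      M c (u + t • (v - u)) ≤ (1 - t) * M c u + t * M c v
        - ((r₁ - ℓ₁) / 2 * ‖v - u‖ ^ 2) * (t * (1 - t)) := by
    intro c u hu v hv t ht
    apply hMle
    intro s hs
    have h1 := aux_weak P hPconv (fun z => f z s) (fun z => gπ z s) (fun z => hgπ z s) ℓ₁
      (fun z hz w hw => by simpa using hlipπ z hz w hw s hs s hs) u v hu hv t ht
    have h2 := mul_le_mul_of_nonneg_left (hle c u s hs) (sub_nonneg.2 ht.2)
    have h3 := mul_le_mul_of_nonneg_left (hle c v s hs) ht.1
    unfold chi at h2 h3 ⊢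
    rw [aux_quad]
    linarith
  have hshift : ∀ z, M a z - r₁ / 2 * ‖z - a‖ ^ 2 = M b z - r₁ / 2 * ‖z - b‖ ^ 2 := by
    have key : ∀ c d z, M c z - r₁ / 2 * ‖z - c‖ ^ 2 ≤ M d z - r₁ / 2 * ‖z - d‖ ^ 2 := by
      intro c d z
      have : M c z ≤ M d z - r₁ / 2 * ‖z - d‖ ^ 2 + r₁ / 2 * ‖z - c‖ ^ 2 := by
        apply hMle
        intro s hs
        have := hle d z s hs
        unfold chi at this ⊢
        linarith
      linarith
    exact fun z => le_antisymm (key a b z) (key b a z)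
  have m1 := aux_strong_min P hPconv (M a) _ x y hx hy hxm (hstrong a x hx y hy)
  have m2 := aux_strong_min P hPconv (M b) _ y x hy hx hym (hstrong b y hy x hx)
  have hpi : ‖y - x‖ ≤ r₁ / (r₁ - ℓ₁) * ‖a - b‖ := by
    have s1 := hshift x
    have s2 := hshift y
    rw [norm_sub_rev x y] at m2
    have e : ‖y - a‖ ^ 2 - ‖y - b‖ ^ 2 - ‖x - a‖ ^ 2 + ‖x - b‖ ^ 2 = - 2 * (inner ℝ (y - x) (a - b)) := by
      simp only [norm_sub_sq_real, inner_sub_left, inner_sub_right]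
      ring
    have c1 := abs_le.1 (abs_real_inner_le_norm (y - x) (a - b))
    have c2 : (r₁ - ℓ₁) * ‖y - x‖ ^ 2 ≤ r₁ * (‖y - x‖ * ‖a - b‖) := by
      have : r₁ * (- (inner ℝ (y - x) (a - b))) ≤ r₁ * (‖y - x‖ * ‖a - b‖) :=
        mul_le_mul_of_nonneg_left (by linarith) (by linarith)
      have e' := congrArg (fun w => r₁ / 2 * w) e
      linarith
    rw [div_mul_eq_mul_div, le_div_iff₀ hμ]
    rcases (norm_nonneg (y - x)).eq_or_lt with h0 | h0
    · rw [← h0, zero_mul]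
      exact mul_nonneg (by linarith) (norm_nonneg _)
    · refine le_of_mul_le_mul_left ?_ h0
      linarith
  refine ⟨hpi, ?_⟩
  have hstrongp : ∀ c, ∀ z ∈ P, ∀ u ∈ Q, ∀ v ∈ Q, ∀ t ∈ Set.Icc (0 : ℝ) 1,
      -chi f r₁ r₂ z (u + t • (v - u)) c pb ≤ (1 - t) * (-chi f r₁ r₂ z u c pb)
        + t * (-chi f r₁ r₂ z v c pb) - ((r₂ - ℓ₂) / 2 * ‖v - u‖ ^ 2) * (t * (1 - t)) := by
    intro c z hz u hu v hv t ht
    have h1 := aux_weak Q hQconv (fun s => -f z s) (fun s => -gp z s)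
      (fun s => by
        have := (hgp z s).hasFDerivAt.neg
        rw [hasGradientAt_iff_hasFDerivAt, map_neg]
        exact this) ℓ₂
      (fun s hs w hw => by
        have := hlipp z hz z hz w hw s hs
        rw [neg_sub_neg, norm_sub_rev s w]
        simpa using this) u v hu hv t ht
    unfold chi
    rw [aux_quad]
    linarith
  have n1 := aux_strong_min Q hQconv (fun s => -chi f r₁ r₂ x s a pb) _ p q hp hq
    (fun s hs => neg_le_neg (hpm s hs)) (hstrongp a x hx p hp q hq)
  have n2 := aux_strong_min Q hQconv (fun s => -chi f r₁ r₂ y s b pb) _ q p hq hp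
    (fun s hs => neg_le_neg (hqm s hs)) (hstrongp b y hy q hq p hp)
  have hmv : ‖(f x p - f y p) - (f x q - f y q)‖ ≤ ℓ₂ * ‖x - y‖ * ‖p - q‖ := by
    refine hQconv.norm_image_sub_le_of_norm_hasFDerivWithin_le (f := fun s => f x s - f y s)
      (fun s _ => ((hgp x s).hasFDerivAt.sub (hgp y s).hasFDerivAt).hasFDerivWithinAt) ?_ hq hp
    intro s hs
    rw [← map_sub, LinearIsometryEquiv.norm_map]
    simpa using hlipp x hx y hy s hs s hs
  have hmv' := (abs_le.1 hmv).2
  rw [norm_sub_rev q p] at n1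
  unfold chi at n1 n2
  have q1 : (r₂ - ℓ₂) * ‖p - q‖ ^ 2 ≤ ℓ₂ * ‖x - y‖ * ‖p - q‖ := by
    linarith
  have q2 : ‖p - q‖ * (r₂ - ℓ₂) ≤ ℓ₂ * ‖x - y‖ := by
    rcases (norm_nonneg (p - q)).eq_or_lt with h0 | h0
    · rw [← h0, zero_mul]
      positivity
    · refine le_of_mul_le_mul_left ?_ h0
      linarith
  have hr : 0 < r₁ := by linarith
  have hpos : 0 ≤ (r₁ / (r₁ - ℓ₁)) / (ℓ₂ / (r₁ - ℓ₁) + 1) := by positivity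
  have q3 : ‖p - q‖ ≤ r₁ * (ℓ₂ / (r₁ - ℓ₁) + 1) / (r₂ - ℓ₂) * ‖a - b‖ := by
    rw [div_mul_eq_mul_div, le_div_iff₀ hν]
    refine q2.trans ?_
    rw [norm_sub_rev x y]
    refine (mul_le_mul_of_nonneg_left hpi hℓ₂.le).trans ?_
    have e : ℓ₂ * (r₁ / (r₁ - ℓ₁) * ‖a - b‖) = r₁ * (ℓ₂ / (r₁ - ℓ₁)) * ‖a - b‖ := by ring
    rw [e]
    gcongr
    linarith
  rw [add_mul]
  have := mul_nonneg hpos (norm_nonneg (a - b))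
  linarith
end

section
/- (Sufficient descent of the Lyapunov function) Let (π,p,π̄,p̄) with π ∈ Π, p ∈ 𝒫 be given, and define one step of the single-loop robust policy gradient method by π⁺ := Proj_Π(π − τ∇_πχ(π,p,π̄,p̄)), p⁺ := Proj_𝒫(p + σ∇_pχ(π⁺,p,π̄,p̄)), π̄⁺ := π̄ + β(π⁺−π̄), p̄⁺ := p̄ + μ(p⁺−p̄). Also set p° := Proj_𝒫(p + σ∇_pχ(π(p,π̄,p̄),p,π̄,p̄)) and b⁺ := p̄ + μ(p(π̄⁺,p̄) − p̄), and let p̄* ∈ E₂ be a point attaining sup_{b∈E₂}φ_{π,p}(π̄⁺,b). Then Φ(π,p,π̄,p̄) − Φ(π⁺,p⁺,π̄⁺,p̄⁺) ≥ (r₁/32)‖π⁺−π‖² + (r₂/15)‖p−p°‖² + (r₁/(5β))‖π̄−π̄⁺‖² + (r₂/(4μ))‖b⁺−p̄‖² − 4r₁β‖π(π̄⁺, p̄*) − π(π̄⁺, b⁺)‖². -/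
open scoped RealInnerProductSpace

section helpers
variable {E : Type*} [NormedAddCommGroup E] [InnerProductSpace ℝ E]

theorem aux_descent [CompleteSpace E] (h : E → ℝ) (g : E → E) (S : Set E) (hS : Convex ℝ S) (L : ℝ)
    (hg : ∀ x, HasGradientAt h (g x) x)
    (hlip : ∀ x ∈ S, ∀ y ∈ S, ‖g x - g y‖ ≤ L * ‖x - y‖) (a b : E) (ha : a ∈ S) (hb : b ∈ S) :
    h b ≤ h a + ⟪g a, b - a⟫ + L / 2 * ‖b - a‖ ^ 2 := by
  have hline : ∀ t : ℝ, HasDerivAt (fun t : ℝ => a + t • (b - a)) (b - a) t := by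
    intro t
    simpa using ((hasDerivAt_id t).smul_const (b - a)).const_add a
  have hd : ∀ t : ℝ, HasDerivAt
      (fun t : ℝ => h (a + t • (b - a)) - t * ⟪g a, b - a⟫ - L / 2 * t ^ 2 * ‖b - a‖ ^ 2)
      (⟪g (a + t • (b - a)), b - a⟫ - ⟪g a, b - a⟫ - L * t * ‖b - a‖ ^ 2) t := by
    intro t
    have h1 : HasDerivAt (fun t : ℝ => h (a + t • (b - a))) ⟪g (a + t • (b - a)), b - a⟫ t := by
      have := (hg (a + t • (b - a))).hasFDerivAt.comp_hasDerivAt t (hline t)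
      rw [InnerProductSpace.toDual_apply_apply] at this
      exact this
    have h2 : HasDerivAt (fun t : ℝ => t * ⟪g a, b - a⟫) ⟪g a, b - a⟫ t := by
      simpa using (hasDerivAt_id t).mul_const ⟪g a, b - a⟫
    have h3 : HasDerivAt (fun t : ℝ => L / 2 * t ^ 2 * ‖b - a‖ ^ 2) (L * t * ‖b - a‖ ^ 2) t := by
      have := ((hasDerivAt_pow 2 t).const_mul (L / 2)).mul_const (‖b - a‖ ^ 2)
      refine this.congr_deriv ?_
      push_cast; ring
    exact (h1.sub h2).sub h3
  have hanti : AntitoneOn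
      (fun t : ℝ => h (a + t • (b - a)) - t * ⟪g a, b - a⟫ - L / 2 * t ^ 2 * ‖b - a‖ ^ 2)
      (Set.Icc 0 1) := by
    apply antitoneOn_of_deriv_nonpos (convex_Icc 0 1)
    · exact fun t _ => (hd t).continuousAt.continuousWithinAt
    · exact fun t _ => (hd t).differentiableAt.differentiableWithinAt
    · intro t ht
      rw [interior_Icc] at ht
      rw [(hd t).deriv]
      have hm : a + t • (b - a) ∈ S := by
        have := hS.add_smul_sub_mem ha hb ⟨ht.1.le, ht.2.le⟩
        exact this
      have h1 := hlip _ hm a ha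
      have h2 : ‖a + t • (b - a) - a‖ = t * ‖b - a‖ := by
        rw [add_sub_cancel_left, norm_smul, Real.norm_of_nonneg ht.1.le]
      rw [h2] at h1
      have h3 := real_inner_le_norm (g (a + t • (b - a)) - g a) (b - a)
      rw [inner_sub_left] at h3
      nlinarith [norm_nonneg (b - a)]
  have := hanti (Set.left_mem_Icc.2 zero_le_one) (Set.right_mem_Icc.2 zero_le_one) zero_le_one
  simp at this
  linarith

theorem aux_descent' [CompleteSpace E] (h : E → ℝ) (g : E → E) (S : Set E) (hS : Convex ℝ S) (L : ℝ)
    (hg : ∀ x, HasGradientAt h (g x) x)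
    (hlip : ∀ x ∈ S, ∀ y ∈ S, ‖g x - g y‖ ≤ L * ‖x - y‖) (a b : E) (ha : a ∈ S) (hb : b ∈ S) :
    h a + ⟪g a, b - a⟫ - L / 2 * ‖b - a‖ ^ 2 ≤ h b := by
  have := aux_descent (fun x => - h x) (fun x => - g x) S hS L
    (fun x => by
      have := (hg x).hasFDerivAt.neg
      rw [hasGradientAt_iff_hasFDerivAt, map_neg]
      exact this)
    (fun x hx y hy => by
      have := hlip x hx y hy
      rw [← norm_neg] at this
      have e1 : - g x - - g y = -(g x - g y) := by abel
      simp only [e1]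
      exact this) a b ha hb
  rw [inner_neg_left] at this
  linarith

theorem aux_VI (m : ℝ) (u u' G Gu' G' : E)
    (hmono : m * ‖u' - u‖ ^ 2 ≤ ⟪Gu' - G, u' - u⟫)
    (h1 : 0 ≤ ⟪G, u' - u⟫) (h2 : ⟪G', u' - u⟫ ≤ 0) : m * ‖u' - u‖ ≤ ‖Gu' - G'‖ := by
  rcases eq_or_lt_of_le (norm_nonneg (u' - u)) with h | h
  · rw [← h]; simp
  · have h3 := real_inner_le_norm (Gu' - G') (u' - u)
    rw [inner_sub_left] at h3 hmono
    have : m * ‖u' - u‖ * ‖u' - u‖ ≤ ‖Gu' - G'‖ * ‖u' - u‖ := by nlinarith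
    exact le_of_mul_le_mul_right this h

theorem aux_sq (x x' z : E) :
    ‖x' - z‖ ^ 2 = ‖x - z‖ ^ 2 + 2 * ⟪x - z, x' - x⟫ + ‖x' - x‖ ^ 2 := by
  have : x' - z = (x - z) + (x' - x) := by abel
  rw [this, norm_add_sq_real]

theorem aux_scalar (a c : ℝ) (h : ∀ t : ℝ, 0 < t → t ≤ 1 → 0 ≤ t * a + t ^ 2 * c) : 0 ≤ a := by
  by_contra ha
  push Not at ha
  have hc : 0 < |c| + 1 := by positivity
  have hq : 0 < -a / (2 * (|c| + 1) - a) := div_pos (by linarith) (by linarith)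
  have hq1 : -a / (2 * (|c| + 1) - a) ≤ 1 := by
    rw [div_le_one (by linarith)]; linarith
  have h1 := h _ hq hq1
  set t := -a / (2 * (|c| + 1) - a)
  have ht : t * (2 * (|c| + 1) - a) = -a := div_mul_cancel₀ _ (by linarith : (2 * (|c| + 1) - a) ≠ 0).symm.symm
  have h2 : 0 ≤ a + t * c := by
    by_contra h3
    push Not at h3
    nlinarith
  have h4 : c ≤ |c| := le_abs_self c
  nlinarith

/-- First order optimality from a quadratic upper bound. -/
theorem aux_opt (S : Set E) (hS : Convex ℝ S) (F : E → ℝ) (x G : E) (C : ℝ) (hx : x ∈ S)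
    (hmin : ∀ u ∈ S, F x ≤ F u)
    (hup : ∀ u ∈ S, F u ≤ F x + ⟪G, u - x⟫ + C * ‖u - x‖ ^ 2) (u : E) (hu : u ∈ S) :
    0 ≤ ⟪G, u - x⟫ := by
  apply aux_scalar _ (C * ‖u - x‖ ^ 2)
  intro t ht ht1
  have hm : x + t • (u - x) ∈ S := hS.add_smul_sub_mem hx hu ⟨ht.le, ht1⟩
  have h1 := hmin _ hm
  have h2 := hup _ hm
  rw [add_sub_cancel_left, inner_smul_right, norm_smul, Real.norm_of_nonneg ht.le] at h2
  nlinarith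
end helpers

set_option maxHeartbeats 1000000 in
theorem aux_num (L lam r₁ r₂ τ σ β μ ℓ κ : ℝ) (hL : 0 < L) (hlam : 0 < lam) (hℓ : ℓ = lam * L)
    (hr₁ : 2 * L ≤ r₁) (hr₂ : 2 * ℓ ≤ r₂) (hτ0 : 0 < τ) (hτ1 : 3 / 4 * (L + r₁) ≤ 1 / τ)
    (hτ2 : 6 * ℓ ≤ 1 / τ) (hσ0 : 0 < σ) (hκ : 0 ≤ κ) (hσ1 : σ * ℓ * κ ^ 2 ≤ 2 / 3)
    (hσ2 : 6 * (2 * ℓ + r₂) * σ ≤ 1) (hβ0 : 0 < β) (hβ1 : β ≤ 1 / 15)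
    (hβ2 : 1920 * (r₁ * β) ≤ σ * ℓ ^ 2) (hβ3 : 1920 * (r₁ * β) ≤ σ * L ^ 2)
    (hμ0 : 0 < μ) (hμ1 : μ ≤ 1 / 2) (hμ2 : 320 * (r₂ * μ) ≤ σ * ℓ ^ 2)
    (a b s w A B T D e g X Y Δ : ℝ) (ha : 0 ≤ a) (hb : 0 ≤ b) (hs : 0 ≤ s) (hw : 0 ≤ w)
    (hA : 0 ≤ A) (hB : 0 ≤ B) (hT : 0 ≤ T) (hD : 0 ≤ D) (he : 0 ≤ e) (hg : 0 ≤ g) (hX : 0 ≤ X)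
    (hY : 0 ≤ Y)
    (hΔ : (1 / τ - (L + r₁) / 2) * a ^ 2 + (1 / σ - (3 * ℓ + r₂)) * b ^ 2 - 2 * ℓ * X * b
      + r₁ * (2 - β) / (2 * β) * w ^ 2 + r₂ * (2 - μ) / (2 * μ) * A ^ 2
      - 2 * r₁ * w * (2 * w + T + Y) ≤ Δ)
    (h1 : Y ≤ 2 * B + D) (h2 : D ≤ e + g + 2 * w) (h3 : e ≤ σ * ℓ * X)
    (h4 : (r₂ - ℓ) * g ≤ (2 * ℓ + r₂ + 1 / σ) * s) (h5 : X ≤ κ * a) (h6 : B ≤ A + μ * D)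
    (h7 : s ≤ b + e) :
    r₁ / 32 * a ^ 2 + r₂ / 15 * s ^ 2 + r₁ / (5 * β) * w ^ 2 + r₂ / (4 * μ) * B ^ 2
      - 4 * r₁ * β * T ^ 2 ≤ Δ := by
  have hℓ0 : 0 < ℓ := by rw [hℓ]; positivity
  have hr₁0 : 0 < r₁ := by linarith
  have hr₂0 : 0 < r₂ := by linarith
  obtain ⟨S, hS⟩ : ∃ S, S = 1 / σ := ⟨_, rfl⟩
  have hS0 : 0 < S := by rw [hS]; positivity
  have hSσ : S * σ = 1 := by rw [hS]; field_simp
  have hS1 : 6 * (2 * ℓ + r₂) ≤ S := by rw [hS, le_div_iff₀ hσ0]; exact hσ2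
  have hSκ : ℓ * κ ^ 2 ≤ 2 / 3 * S := by
    have := mul_le_mul_of_nonneg_left hσ1 hS0.le
    have e1 : S * (σ * ℓ * κ ^ 2) = ℓ * κ ^ 2 := by
      rw [show S * (σ * ℓ * κ ^ 2) = (S * σ) * (ℓ * κ ^ 2) by ring, hSσ, one_mul]
    linarith
  have hσℓ : σ * ℓ ≤ 1 / 24 := by
    have := mul_le_mul_of_nonneg_right hr₂ hσ0.le
    linarith
  have hσℓ0 : 0 < σ * ℓ := by positivity
  rw [← hS] at hΔ h4
  -- cross term
  have c1 : 2 * ℓ * X * b ≤ ℓ * a ^ 2 + 2 / 3 * S * b ^ 2 := by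
    have t1 : 2 * ℓ * X * b ≤ 2 * ℓ * (κ * a) * b := by gcongr
    have t2 : ℓ * κ ^ 2 * b ^ 2 ≤ 2 / 3 * S * b ^ 2 := by gcongr
    linarith [mul_nonneg hℓ0.le (sq_nonneg (a - κ * b))]
  -- e
  have c2 : e ^ 2 ≤ 2 / 3 * σ * ℓ * a ^ 2 := by
    have t1 : e ≤ σ * ℓ * (κ * a) := h3.trans (by gcongr)
    have t2 : e ^ 2 ≤ (σ * ℓ * (κ * a)) ^ 2 := by gcongr
    have t3 : σ * ℓ * κ ^ 2 * (σ * ℓ * a ^ 2) ≤ 2 / 3 * (σ * ℓ * a ^ 2) := by gcongr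
    have t4 : (σ * ℓ * (κ * a)) ^ 2 = σ * ℓ * κ ^ 2 * (σ * ℓ * a ^ 2) := by ring
    linarith
  have c3 : s ^ 2 / 2 - e ^ 2 ≤ b ^ 2 := by
    have : s ^ 2 ≤ (b + e) ^ 2 := by gcongr
    linarith [sq_nonneg (b - e)]
  have c4 : S / 16 * s ^ 2 - ℓ * a ^ 2 / 12 ≤ (1 / 8) * S * b ^ 2 := by
    have t1 : S * (s ^ 2 / 2 - e ^ 2) ≤ S * b ^ 2 := by gcongr
    have t2 : S * e ^ 2 ≤ S * (2 / 3 * σ * ℓ * a ^ 2) := by gcongr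
    have t3 : S * (2 / 3 * σ * ℓ * a ^ 2) = 2 / 3 * ℓ * a ^ 2 := by
      rw [show S * (2 / 3 * σ * ℓ * a ^ 2) = (S * σ) * (2 / 3 * ℓ * a ^ 2) by ring, hSσ, one_mul]
    linarith
  have c5 : (1 / 8) * S * b ^ 2 ≤ (S - (3 * ℓ + r₂)) * b ^ 2 - 2 / 3 * S * b ^ 2 := by
    have : 0 ≤ (S - (3 * ℓ + r₂) - 2 / 3 * S - 1 / 8 * S) * b ^ 2 :=
      mul_nonneg (by linarith) (sq_nonneg _)
    linarith
  -- g
  have c6 : σ * ℓ ^ 2 * g ^ 2 ≤ 49 / 36 * S * s ^ 2 := by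
    have t1 : ℓ * g ≤ 7 / 6 * S * s := by
      have u1 : ℓ * g ≤ (r₂ - ℓ) * g := by gcongr; linarith
      have u2 : (2 * ℓ + r₂ + S) * s ≤ 7 / 6 * S * s := by gcongr; linarith
      linarith
    have t2 : (ℓ * g) ^ 2 ≤ (7 / 6 * S * s) ^ 2 := by gcongr
    have t3 : σ * (ℓ * g) ^ 2 ≤ σ * (7 / 6 * S * s) ^ 2 := by gcongr
    have t4 : σ * (7 / 6 * S * s) ^ 2 = (S * σ) * (49 / 36 * S * s ^ 2) := by ring
    rw [t4, hSσ] at t3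
    linarith
  -- D
  have c7 : D ^ 2 ≤ 2 * g ^ 2 + 4 * e ^ 2 + 16 * w ^ 2 := by
    have : D ^ 2 ≤ (e + g + 2 * w) ^ 2 := by gcongr
    linarith [sq_nonneg (g - (e + 2 * w)), sq_nonneg (e - 2 * w)]
  obtain ⟨C, hC⟩ : ∃ C, C = 3 / 4 * (r₂ * μ) + 16 * (r₁ * β) := ⟨_, rfl⟩
  have hC0 : 0 ≤ C := by rw [hC]; positivity
  have hC1 : C ≤ 107 / 10000 * (σ * ℓ ^ 2) := by
    have : 0 ≤ σ * ℓ ^ 2 := by positivity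
    linarith
  have c8 : C * D ^ 2 ≤ 3 / 100 * S * s ^ 2 + ℓ * a ^ 2 / 100 + r₁ / 20 * w ^ 2 / β := by
    have t1 : C * D ^ 2 ≤ 107 / 10000 * (σ * ℓ ^ 2) * (2 * g ^ 2 + 4 * e ^ 2 + 16 * w ^ 2) := by
      gcongr
    have t2 : σ * ℓ ^ 2 * e ^ 2 ≤ ℓ * a ^ 2 / 100 := by
      have u1 : σ * ℓ ^ 2 * e ^ 2 ≤ σ * ℓ ^ 2 * (2 / 3 * σ * ℓ * a ^ 2) := by gcongr
      have u2 : (σ * ℓ) * (σ * ℓ) ≤ 1 / 24 * (1 / 24) := by gcongr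
      have u3 : (σ * ℓ) * (σ * ℓ) * (2 / 3 * ℓ * a ^ 2) ≤ 1 / 24 * (1 / 24) * (2 / 3 * ℓ * a ^ 2) := by
        gcongr
      have u4 : 0 ≤ ℓ * a ^ 2 := by positivity
      have u5 : σ * ℓ ^ 2 * (2 / 3 * σ * ℓ * a ^ 2) = (σ * ℓ) * (σ * ℓ) * (2 / 3 * ℓ * a ^ 2) := by ring
      linarith
    have t3 : σ * ℓ ^ 2 * w ^ 2 ≤ r₁ / 10 * w ^ 2 / β := by
      rw [le_div_iff₀ hβ0]
      have u1 : σ * ℓ ^ 2 * β ≤ r₁ / 10 := by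
        have v1 : (σ * ℓ) * (σ * ℓ) ≤ 1 / 24 * (1 / 24) := by gcongr
        have v2 : (σ * ℓ) * (σ * ℓ) * L ^ 2 ≤ 1 / 24 * (1 / 24) * L ^ 2 := by gcongr
        have v3 : σ * ℓ ^ 2 * (1920 * (r₁ * β)) ≤ σ * ℓ ^ 2 * (σ * L ^ 2) := by gcongr
        have v4 : L ^ 2 ≤ r₁ ^ 2 := by gcongr; linarith
        have v5 : (σ * ℓ ^ 2 * β) * r₁ ≤ r₁ / 10 * r₁ := by linarith [sq_nonneg r₁]
        exact le_of_mul_le_mul_right v5 hr₁0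
      have u2 : (σ * ℓ ^ 2 * β) * w ^ 2 ≤ r₁ / 10 * w ^ 2 := by gcongr
      linarith
    have t4 : 0 ≤ ℓ * a ^ 2 := by positivity
    have t5 : 0 ≤ S * s ^ 2 := by positivity
    have t6 : r₁ / 20 * w ^ 2 / β = (r₁ / 10 * w ^ 2 / β) / 2 := by ring
    have t7 : 0 ≤ r₁ / 10 * w ^ 2 / β := by positivity
    rw [t6]
    linarith
  -- Y
  have c9 : 2 * r₁ * w * Y ≤ r₁ / (8 * β) * w ^ 2 + 8 * r₁ * β * (8 * B ^ 2 + 2 * D ^ 2) := by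
    have t1 : Y ^ 2 ≤ 8 * B ^ 2 + 2 * D ^ 2 := by
      have : Y ^ 2 ≤ (2 * B + D) ^ 2 := by gcongr
      linarith [sq_nonneg (2 * B - D)]
    have t2 : 8 * r₁ * β * Y ^ 2 ≤ 8 * r₁ * β * (8 * B ^ 2 + 2 * D ^ 2) := by gcongr
    have t3 : r₁ / (8 * β) * w ^ 2 + 8 * r₁ * β * Y ^ 2 - 2 * r₁ * w * Y
        = r₁ / (8 * β) * (w - 8 * β * Y) ^ 2 := by field_simp; ring
    have t4 : 0 ≤ r₁ / (8 * β) * (w - 8 * β * Y) ^ 2 := by positivity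
    linarith
  have c10 : 2 * r₁ * w * T ≤ r₁ / (4 * β) * w ^ 2 + 4 * r₁ * β * T ^ 2 := by
    have t3 : r₁ / (4 * β) * w ^ 2 + 4 * r₁ * β * T ^ 2 - 2 * r₁ * w * T
        = r₁ / (4 * β) * (w - 4 * β * T) ^ 2 := by field_simp; ring
    have t4 : 0 ≤ r₁ / (4 * β) * (w - 4 * β * T) ^ 2 := by positivity
    linarith
  -- A
  have c11 : 3 / 8 * (r₂ / μ) * B ^ 2 - 3 / 4 * (r₂ * μ) * D ^ 2 ≤ r₂ * (2 - μ) / (2 * μ) * A ^ 2 := by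
    have t1 : B ^ 2 ≤ 2 * A ^ 2 + 2 * (μ * D) ^ 2 := by
      have : B ^ 2 ≤ (A + μ * D) ^ 2 := by gcongr
      linarith [sq_nonneg (A - μ * D)]
    have t2 : 3 / 8 * (r₂ / μ) * B ^ 2 ≤ 3 / 8 * (r₂ / μ) * (2 * A ^ 2 + 2 * (μ * D) ^ 2) := by gcongr
    have t3 : 3 / 8 * (r₂ / μ) * (2 * A ^ 2 + 2 * (μ * D) ^ 2)
        = 3 / 4 * (r₂ / μ) * A ^ 2 + 3 / 4 * (r₂ * μ) * D ^ 2 := by field_simp; ring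
    have t4 : r₂ * (2 - μ) / (2 * μ) * A ^ 2 - 3 / 4 * (r₂ / μ) * A ^ 2
        = (r₂ / μ) * A ^ 2 * (1 / 4 - μ / 2) := by field_simp; ring
    have t5 : 0 ≤ (r₂ / μ) * A ^ 2 * (1 / 4 - μ / 2) :=
      mul_nonneg (by positivity) (by linarith)
    linarith
  have c12 : 64 * (r₁ * β) * B ^ 2 ≤ 1 / 8 * (r₂ / μ) * B ^ 2 := by
    have t1 : r₂ ≤ r₂ / μ := by rw [le_div_iff₀ hμ0]; nlinarith only [hr₂0, hμ1]
    have t2 : 64 * (r₁ * β) ≤ 1 / 8 * (r₂ / μ) := by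
      have u1 : σ * ℓ * ℓ ≤ 1 / 24 * ℓ := by gcongr
      linarith
    gcongr
  have c13 : r₂ / 15 * s ^ 2 ≤ 1 / 90 * S * s ^ 2 := by
    gcongr; linarith
  have c14 : r₁ / 32 * a ^ 2 + (1 + 1 / 12 + 1 / 100) * ℓ * a ^ 2 ≤ (1 / τ - (L + r₁) / 2) * a ^ 2 := by
    have : 0 ≤ (1 / τ - (L + r₁) / 2 - r₁ / 32 - (1 + 1 / 12 + 1 / 100) * ℓ) * a ^ 2 :=
      mul_nonneg (by linarith) (sq_nonneg _)
    linarith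
  have c15 : r₁ / (5 * β) * w ^ 2 + 4 * r₁ * w ^ 2 + r₁ / (4 * β) * w ^ 2 + r₁ / (8 * β) * w ^ 2
      + r₁ / 20 * w ^ 2 / β ≤ r₁ * (2 - β) / (2 * β) * w ^ 2 := by
    have t1 : r₁ * (2 - β) / (2 * β) * w ^ 2 - (r₁ / (5 * β) * w ^ 2 + 4 * r₁ * w ^ 2
        + r₁ / (4 * β) * w ^ 2 + r₁ / (8 * β) * w ^ 2 + r₁ / 20 * w ^ 2 / β)
        = r₁ / β * w ^ 2 * (1 - β / 2 - 1 / 5 - 4 * β - 1 / 4 - 1 / 8 - 1 / 20) := by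
      field_simp; ring
    have t2 : 0 ≤ r₁ / β * w ^ 2 * (1 - β / 2 - 1 / 5 - 4 * β - 1 / 4 - 1 / 8 - 1 / 20) :=
      mul_nonneg (by positivity) (by linarith)
    linarith
  have c16 : r₂ / (4 * μ) * B ^ 2 = 1 / 4 * (r₂ / μ) * B ^ 2 := by field_simp
  have c17 : 0 ≤ S * s ^ 2 := by positivity
  rw [hC] at c8
  rw [c16]
  linarith

set_option maxHeartbeats 4000000 in
/-- Statement 14 (sufficient descent of the Lyapunov function) for one step of the
single-loop robust policy gradient method. -/
theorem lyapunov_sufficient_descent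
    {E₁ : Type*} [NormedAddCommGroup E₁] [InnerProductSpace ℝ E₁] [FiniteDimensional ℝ E₁]
    {E₂ : Type*} [NormedAddCommGroup E₂] [InnerProductSpace ℝ E₂] [FiniteDimensional ℝ E₂]
    (P : Set E₁) (Q : Set E₂)
    (hPne : P.Nonempty) (hPcpt : IsCompact P) (hPconv : Convex ℝ P)
    (hQne : Q.Nonempty) (hQcpt : IsCompact Q) (hQconv : Convex ℝ Q)
    (f : E₁ → E₂ → ℝ) (hf : ContDiff ℝ 1 (fun q : E₁ × E₂ => f q.1 q.2))
    (gπ : E₁ → E₂ → E₁) (gp : E₁ → E₂ → E₂)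
    (hgπ : ∀ π p, HasGradientAt (fun π' => f π' p) (gπ π p) π)
    (hgp : ∀ π p, HasGradientAt (fun p' => f π p') (gp π p) p)
    (L lam : ℝ) (hL : 0 < L) (hlam : 0 < lam)
    (hlipπ : ∀ π ∈ P, ∀ π' ∈ P, ∀ p ∈ Q, ∀ p' ∈ Q,
      ‖gπ π p - gπ π' p'‖ ≤ L * (‖π - π'‖ + ‖p - p'‖))
    (hlipp : ∀ π ∈ P, ∀ π' ∈ P, ∀ p ∈ Q, ∀ p' ∈ Q,
      ‖gp π p - gp π' p'‖ ≤ lam * L * (‖π - π'‖ + ‖p - p'‖))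
    (r₁ r₂ τ σ β μ : ℝ)
    -- parameter conditions
    (hr₁ : 2 * L ≤ r₁) (hr₂ : 2 * lam * L ≤ r₂)
    (hτ0 : 0 < τ) (hτ1 : τ ≤ 4 / (3 * (L + r₁))) (hτ2 : τ ≤ 1 / (6 * lam * L))
    (hσ0 : 0 < σ)
    (hσ1 : σ ≤ 2 / (3 * lam * L * ((2 * τ * r₁ + 1) / (τ * (r₁ - L))) ^ 2))
    (hσ2 : σ ≤ 1 / (6 * (lam * L * (lam * L / (r₁ - L) + 1) + lam * L + r₂)))
    (hσ3 : σ ≤ 1 / (5 * lam * Real.sqrt (lam + 5) * L))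
    (hβ0 : 0 < β)
    (hβ1 : β ≤ 24 * r₁ / (360 * r₁ + 5 * r₁ ^ 2 * lam + (2 * lam * L + 5 * r₁) ^ 2))
    (hβ2 : β ≤ σ * lam ^ 2 * L ^ 2 / (384 * r₁ * (lam + 5) * (lam + 1) ^ 2))
    (hβ3 : β < 1)
    (hμ0 : 0 < μ)
    (hμ1 : μ ≤ (lam + 5) / (2 * (lam + 5) + lam ^ 2 * L ^ 2))
    (hμ2 : μ ≤ (lam + 5) / (σ * lam ^ 2 * L ^ 2))
    (hμ3 : μ ≤ σ * lam ^ 2 * L ^ 2 / (64 * r₂ * (lam + 5)))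
    (hμ4 : μ < 1)
    -- metric projections onto `Π` and `𝒫`
    (projP : E₁ → E₁)
    (hprojP : ∀ z : E₁, projP z ∈ P ∧ ∀ y ∈ P, ⟪z - projP z, y - projP z⟫ ≤ 0)
    (projQ : E₂ → E₂)
    (hprojQ : ∀ z : E₂, projQ z ∈ Q ∧ ∀ y ∈ Q, ⟪z - projQ z, y - projQ z⟫ ≤ 0)
    -- `πsel p π̄ p̄` is the unique minimizer of `π' ↦ χ(π',p,π̄,p̄)` over `Π`,
    -- so `φ_π(p,π̄,p̄) = χ(πsel p π̄ p̄, p, π̄, p̄)`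
    (πsel : E₂ → E₁ → E₂ → E₁)
    (hπsel : ∀ (p : E₂) (πb : E₁) (pb : E₂), πsel p πb pb ∈ P ∧
      ∀ π' ∈ P, chi f r₁ r₂ (πsel p πb pb) p πb pb ≤ chi f r₁ r₂ π' p πb pb)
    -- `πsel2 π̄ p̄` is the unique minimizer over `Π` of `π ↦ max_{p∈𝒫} χ(π,p,π̄,p̄)`
    (πsel2 : E₁ → E₂ → E₁)
    (hπsel2 : ∀ (πb : E₁) (pb : E₂), πsel2 πb pb ∈ P ∧
      ∀ π' ∈ P, sSup ((fun p => chi f r₁ r₂ (πsel2 πb pb) p πb pb) '' Q) ≤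
        sSup ((fun p => chi f r₁ r₂ π' p πb pb) '' Q))
    (pselχ : E₁ → E₁ → E₂ → E₂)
    (hpselχ : ∀ (π : E₁) (πb : E₁) (pb : E₂), pselχ π πb pb ∈ Q ∧
      ∀ p' ∈ Q, chi f r₁ r₂ π p' πb pb ≤ chi f r₁ r₂ π (pselχ π πb pb) πb pb)
    -- `φpp π̄ p̄ = min_{π∈Π} max_{p∈𝒫} χ(π,p,π̄,p̄)`
    (φpp : E₁ → E₂ → ℝ)
    (hφpp : ∀ (πb : E₁) (pb : E₂),
      φpp πb pb = chi f r₁ r₂ (πsel2 πb pb) (pselχ (πsel2 πb pb) πb pb) πb pb)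
    -- the supremum `sup_{b} φpp(π̄,b)` is finite
    (hbdd : ∀ πb : E₁, BddAbove (Set.range (φpp πb)))
    -- the Lyapunov function
    (Φ : E₁ → E₂ → E₁ → E₂ → ℝ)
    (hΦ : ∀ (π : E₁) (p : E₂) (πb : E₁) (pb : E₂),
      Φ π p πb pb = chi f r₁ r₂ π p πb pb -
        2 * chi f r₁ r₂ (πsel p πb pb) p πb pb + 2 * sSup (Set.range (φpp πb))) :
    ∀ π ∈ P, ∀ p ∈ Q,
      ∀ (πb : E₁) (pb : E₂) (πp : E₁) (pp : E₂) (πbp : E₁) (pbp p0 bp pbstar : E₂),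
      πp = projP (π - τ • (gπ π p + r₁ • (π - πb))) →
      pp = projQ (p + σ • (gp πp p - r₂ • (p - pb))) →
      πbp = πb + β • (πp - πb) →
      pbp = pb + μ • (pp - pb) →
      p0 = projQ (p + σ • (gp (πsel p πb pb) p - r₂ • (p - pb))) →
      bp = pb + μ • (pselχ (πsel2 πbp pb) πbp pb - pb) →
      (∀ b : E₂, φpp πbp b ≤ φpp πbp pbstar) →
      Φ π p πb pb - Φ πp pp πbp pbp ≥
        r₁ / 32 * ‖πp - π‖ ^ 2 + r₂ / 15 * ‖p - p0‖ ^ 2 +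
          r₁ / (5 * β) * ‖πb - πbp‖ ^ 2 + r₂ / (4 * μ) * ‖bp - pb‖ ^ 2 -
          4 * r₁ * β * ‖πsel2 πbp pbstar - πsel2 πbp bp‖ ^ 2 := by
  obtain ⟨ℓ, hℓ⟩ : ∃ ℓ, ℓ = lam * L := ⟨_, rfl⟩
  have hℓ0 : 0 < ℓ := by rw [hℓ]; positivity
  have hr₂' : 2 * ℓ ≤ r₂ := by rw [hℓ]; linarith
  have hr₁0 : 0 < r₁ := by linarith
  have hr₂0 : 0 < r₂ := by linarith
  have hm1 : 0 < r₁ - L := by linarith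
  have hm2 : 0 < r₂ - ℓ := by linarith
  -- parameters
  obtain ⟨κ, hκ⟩ : ∃ κ, κ = (2 * τ * r₁ + 1) / (τ * (r₁ - L)) := ⟨_, rfl⟩
  have hκ0 : 0 < κ := by rw [hκ]; positivity
  have pσ1 : σ * ℓ * κ ^ 2 ≤ 2 / 3 := by
    rw [← hκ, le_div_iff₀ (by positivity)] at hσ1
    rw [hℓ]; linarith
  have pσ2 : 6 * (2 * ℓ + r₂) * σ ≤ 1 := by
    have h1 : 0 ≤ lam * L / (r₁ - L) := by positivity
    rw [le_div_iff₀ (by positivity), ← hℓ] at hσ2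
    rw [← hℓ] at h1
    have h2 : 0 ≤ σ * (ℓ * (ℓ / (r₁ - L))) := by positivity
    linarith
  have pτ1 : 3 / 4 * (L + r₁) ≤ 1 / τ := by
    rw [le_div_iff₀ (by positivity)] at hτ1
    rw [le_div_iff₀ hτ0]; linarith
  have pτ2 : 6 * ℓ ≤ 1 / τ := by
    rw [le_div_iff₀ (by positivity)] at hτ2
    rw [le_div_iff₀ hτ0, hℓ]; linarith
  have pβ1 : β ≤ 1 / 15 := by
    rw [le_div_iff₀ (by positivity)] at hβ1
    have h1 : 0 ≤ β * (5 * r₁ ^ 2 * lam + (2 * lam * L + 5 * r₁) ^ 2) := by positivity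
    have h2 : β * 15 * r₁ ≤ 1 * r₁ := by linarith
    have := le_of_mul_le_mul_right h2 hr₁0
    linarith
  have hβ2' : 384 * (r₁ * β) * ((lam + 5) * (lam + 1) ^ 2) ≤ σ * lam ^ 2 * L ^ 2 := by
    rw [le_div_iff₀ (by positivity)] at hβ2
    linarith
  have pβ2 : 1920 * (r₁ * β) ≤ σ * ℓ ^ 2 := by
    have h1 : 5 ≤ (lam + 5) * (lam + 1) ^ 2 := by
      have h2 : 0 ≤ lam ^ 3 + 7 * lam ^ 2 + 11 * lam := by positivity
      linarith
    have h2 : 384 * (r₁ * β) * 5 ≤ 384 * (r₁ * β) * ((lam + 5) * (lam + 1) ^ 2) := by gcongr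
    have h3 : σ * ℓ ^ 2 = σ * lam ^ 2 * L ^ 2 := by rw [hℓ]; ring
    linarith
  have pβ3 : 1920 * (r₁ * β) ≤ σ * L ^ 2 := by
    have h1 : 5 * lam ^ 2 ≤ (lam + 5) * (lam + 1) ^ 2 := by
      have h2 : 0 ≤ lam ^ 3 + 2 * lam ^ 2 + 11 * lam + 5 := by positivity
      linarith
    have h2 : 384 * (r₁ * β) * (5 * lam ^ 2) ≤ 384 * (r₁ * β) * ((lam + 5) * (lam + 1) ^ 2) := by
      gcongr
    have h3 : 1920 * (r₁ * β) * lam ^ 2 ≤ σ * L ^ 2 * lam ^ 2 := by linarith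
    exact le_of_mul_le_mul_right h3 (by positivity)
  have pμ1 : μ ≤ 1 / 2 := by
    rw [le_div_iff₀ (by positivity)] at hμ1
    have h1 : 0 ≤ μ * (lam ^ 2 * L ^ 2) := by positivity
    have h2 : μ * (lam + 5) ≤ 1 / 2 * (lam + 5) := by linarith
    exact le_of_mul_le_mul_right h2 (by positivity)
  have pμ2 : 320 * (r₂ * μ) ≤ σ * ℓ ^ 2 := by
    rw [le_div_iff₀ (by positivity)] at hμ3
    have h1 : 0 ≤ μ * r₂ * lam := by positivity
    have h3 : σ * ℓ ^ 2 = σ * lam ^ 2 * L ^ 2 := by rw [hℓ]; ring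
    linarith
  -- partial gradients of the regularized function
  obtain ⟨Gx, hGx⟩ : ∃ Gx : E₁ → E₂ → E₁ → E₁, ∀ x y z, Gx x y z = gπ x y + r₁ • (x - z) :=
    ⟨_, fun _ _ _ => rfl⟩
  obtain ⟨Gy, hGy⟩ : ∃ Gy : E₁ → E₂ → E₂ → E₂, ∀ x y v, Gy x y v = gp x y - r₂ • (y - v) :=
    ⟨_, fun _ _ _ => rfl⟩
  have lipx : ∀ y ∈ Q, ∀ x ∈ P, ∀ x' ∈ P, ‖gπ x y - gπ x' y‖ ≤ L * ‖x - x'‖ := by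
    intro y hy x hx x' hx'
    simpa using hlipπ x hx x' hx' y hy y hy
  have lipy : ∀ x ∈ P, ∀ y ∈ Q, ∀ y' ∈ Q, ‖gp x y - gp x y'‖ ≤ ℓ * ‖y - y'‖ := by
    intro x hx y hy y' hy'
    rw [hℓ]
    simpa using hlipp x hx x hx y hy y' hy'
  have Kx_upper : ∀ x ∈ P, ∀ x' ∈ P, ∀ y ∈ Q, ∀ z v, chi f r₁ r₂ x' y z v ≤
      chi f r₁ r₂ x y z v + ⟪Gx x y z, x' - x⟫ + (r₁ + L) / 2 * ‖x' - x‖ ^ 2 := by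
    intro x hx x' hx' y hy z v
    have h1 := aux_descent (fun u => f u y) (fun u => gπ u y) P hPconv L (fun u => hgπ u y)
      (lipx y hy) x x' hx hx'
    have h2 := aux_sq x x' z
    rw [hGx, inner_add_left, real_inner_smul_left]
    unfold chi
    rw [h2]
    linarith
  have Kx_lower : ∀ x ∈ P, ∀ x' ∈ P, ∀ y ∈ Q, ∀ z v,
      chi f r₁ r₂ x y z v + ⟪Gx x y z, x' - x⟫ + (r₁ - L) / 2 * ‖x' - x‖ ^ 2 ≤
      chi f r₁ r₂ x' y z v := by
    intro x hx x' hx' y hy z v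
    have h1 := aux_descent' (fun u => f u y) (fun u => gπ u y) P hPconv L (fun u => hgπ u y)
      (lipx y hy) x x' hx hx'
    have h2 := aux_sq x x' z
    rw [hGx, inner_add_left, real_inner_smul_left]
    unfold chi
    rw [h2]
    linarith
  have Ky_upper : ∀ x ∈ P, ∀ y ∈ Q, ∀ y' ∈ Q, ∀ z v, chi f r₁ r₂ x y' z v ≤
      chi f r₁ r₂ x y z v + ⟪Gy x y v, y' - y⟫ - (r₂ - ℓ) / 2 * ‖y' - y‖ ^ 2 := by
    intro x hx y hy y' hy' z v
    have h1 := aux_descent (fun u => f x u) (fun u => gp x u) Q hQconv ℓ (fun u => hgp x u)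
      (lipy x hx) y y' hy hy'
    have h2 := aux_sq y y' v
    rw [hGy, inner_sub_left, real_inner_smul_left]
    unfold chi
    rw [h2]
    linarith
  have Ky_lower : ∀ x ∈ P, ∀ y ∈ Q, ∀ y' ∈ Q, ∀ z v,
      chi f r₁ r₂ x y z v + ⟪Gy x y v, y' - y⟫ - (r₂ + ℓ) / 2 * ‖y' - y‖ ^ 2 ≤
      chi f r₁ r₂ x y' z v := by
    intro x hx y hy y' hy' z v
    have h1 := aux_descent' (fun u => f x u) (fun u => gp x u) Q hQconv ℓ (fun u => hgp x u)
      (lipy x hx) y y' hy hy'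
    have h2 := aux_sq y y' v
    rw [hGy, inner_sub_left, real_inner_smul_left]
    unfold chi
    rw [h2]
    linarith
  -- optimality of `πsel`
  have optx : ∀ y ∈ Q, ∀ z v, ∀ u ∈ P, 0 ≤ ⟪Gx (πsel y z v) y z, u - πsel y z v⟫ := by
    intro y hy z v u hu
    exact aux_opt P hPconv (fun u => chi f r₁ r₂ u y z v) (πsel y z v) _ ((r₁ + L) / 2)
      (hπsel y z v).1 (hπsel y z v).2
      (fun u hu => Kx_upper _ (hπsel y z v).1 u hu y hy z v) u hu
  have monox : ∀ x ∈ P, ∀ x' ∈ P, ∀ y ∈ Q, ∀ z,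
      (r₁ - L) * ‖x' - x‖ ^ 2 ≤ ⟪Gx x' y z - Gx x y z, x' - x⟫ := by
    intro x hx x' hx' y hy z
    have h1 := Kx_lower x hx x' hx' y hy z 0
    have h2 := Kx_lower x' hx' x hx y hy z 0
    rw [norm_sub_rev x x', ← neg_sub x' x, inner_neg_right] at h2
    rw [inner_sub_left]
    linarith
  have xlip : ∀ y ∈ Q, ∀ y' ∈ Q, ∀ z z' v v',
      ‖πsel y' z' v' - πsel y z v‖ ≤ ‖y' - y‖ + 2 * ‖z' - z‖ := by
    intro y hy y' hy' z z' v v'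
    have hx := (hπsel y z v).1
    have hx' := (hπsel y' z' v').1
    have h1 := aux_VI (r₁ - L) (πsel y z v) (πsel y' z' v') _ _ (Gx (πsel y' z' v') y' z')
      (monox _ hx _ hx' y hy z) (optx y hy z v _ hx') (by
        have := optx y' hy' z' v' _ hx
        rw [← neg_sub, inner_neg_right] at this
        linarith)
    have h2 : Gx (πsel y' z' v') y z - Gx (πsel y' z' v') y' z' =
        (gπ (πsel y' z' v') y - gπ (πsel y' z' v') y') + r₁ • (z' - z) := by
      rw [hGx, hGx]; module
    have h3 := hlipπ _ hx' _ hx' y hy y' hy'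
    rw [sub_self, norm_zero, zero_add, norm_sub_rev y y'] at h3
    have h4 := norm_add_le (gπ (πsel y' z' v') y - gπ (πsel y' z' v') y') (r₁ • (z' - z))
    rw [norm_smul, Real.norm_of_nonneg hr₁0.le] at h4
    rw [h2] at h1
    have h5 : L * ‖y' - y‖ ≤ (r₁ - L) * ‖y' - y‖ := by gcongr; linarith
    have h6 : r₁ * ‖z' - z‖ ≤ 2 * (r₁ - L) * ‖z' - z‖ := by gcongr; linarith
    have h7 : (r₁ - L) * ‖πsel y' z' v' - πsel y z v‖ ≤ (r₁ - L) * (‖y' - y‖ + 2 * ‖z' - z‖) := by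
      linarith
    exact le_of_mul_le_mul_left h7 hm1
  -- the function `d = φ_π`
  have dlow : ∀ y ∈ Q, ∀ y' ∈ Q, ∀ z v,
      chi f r₁ r₂ (πsel y z v) y z v + ⟪Gy (πsel y z v) y v, y' - y⟫
        - (ℓ + (r₂ + ℓ) / 2) * ‖y' - y‖ ^ 2 ≤ chi f r₁ r₂ (πsel y' z v) y' z v := by
    intro y hy y' hy' z v
    have hx := (hπsel y z v).1
    have hx' := (hπsel y' z v).1
    have h1 := Ky_lower _ hx' y hy y' hy' z v
    have h2 := (hπsel y z v).2 _ hx'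
    have h3 := real_inner_le_norm (Gy (πsel y z v) y v - Gy (πsel y' z v) y v) (y' - y)
    have h4 : Gy (πsel y z v) y v - Gy (πsel y' z v) y v =
        gp (πsel y z v) y - gp (πsel y' z v) y := by rw [hGy, hGy]; abel
    have h5 := hlipp _ hx _ hx' y hy y hy
    rw [sub_self, norm_zero, add_zero, ← hℓ, norm_sub_rev (πsel y z v)] at h5
    have h6 := xlip y hy y' hy' z z v v
    rw [sub_self, norm_zero, mul_zero, add_zero] at h6
    have h7 : ℓ * ‖πsel y' z v - πsel y z v‖ ≤ ℓ * ‖y' - y‖ := by gcongr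
    have h8 : ‖gp (πsel y z v) y - gp (πsel y' z v) y‖ * ‖y' - y‖ ≤ ℓ * ‖y' - y‖ * ‖y' - y‖ := by
      gcongr; linarith
    rw [inner_sub_left, h4] at h3
    linarith
  have dmono : ∀ y ∈ Q, ∀ y' ∈ Q, ∀ z v, (r₂ - ℓ) * ‖y' - y‖ ^ 2 ≤
      ⟪-Gy (πsel y' z v) y' v - -Gy (πsel y z v) y v, y' - y⟫ := by
    intro y hy y' hy' z v
    have hx := (hπsel y z v).1
    have hx' := (hπsel y' z v).1
    have h1 := Ky_upper _ hx y hy y' hy' z v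
    have h2 := Ky_upper _ hx' y' hy' y hy z v
    have h3 := (hπsel y z v).2 _ hx'
    have h4 := (hπsel y' z v).2 _ hx
    rw [norm_sub_rev y y', ← neg_sub y' y, inner_neg_right] at h2
    rw [inner_sub_left, inner_neg_left, inner_neg_left]
    linarith
  have saddle : ∀ z v, πsel2 z v = πsel (pselχ (πsel2 z v) z v) z v ∧
      (∀ u ∈ Q, 0 ≤ ⟪-Gy (πsel (pselχ (πsel2 z v) z v) z v) (pselχ (πsel2 z v) z v) v,
        u - pselχ (πsel2 z v) z v⟫) ∧
      (∀ u ∈ Q, chi f r₁ r₂ (πsel u z v) u z v ≤ φpp z v) := by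
    intro z v
    have hcontx : ContinuousOn (fun y => πsel y z v) Q := by
      have : LipschitzOnWith 1 (fun y => πsel y z v) Q := by
        apply LipschitzOnWith.of_dist_le_mul
        intro y' hy' y hy
        rw [dist_eq_norm, dist_eq_norm]
        simpa using xlip y hy y' hy' z z v v
      exact this.continuousOn
    have hcont : ContinuousOn (fun y => chi f r₁ r₂ (πsel y z v) y z v) Q := by
      have h1 : ContinuousOn (fun y => f (πsel y z v) y) Q :=
        hf.continuous.comp_continuousOn (hcontx.prodMk continuousOn_id)
      unfold chi
      exact (h1.add (((hcontx.sub continuousOn_const).norm.pow 2).const_mul _)).sub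
        (((continuousOn_id.sub continuousOn_const).norm.pow 2).const_mul _)
    obtain ⟨y, hy, hmax⟩ := hQcpt.exists_isMaxOn hQne hcont
    have hmax' : ∀ u ∈ Q, chi f r₁ r₂ (πsel u z v) u z v ≤ chi f r₁ r₂ (πsel y z v) y z v :=
      fun u hu => hmax hu
    have hopt : ∀ u ∈ Q, 0 ≤ ⟪-Gy (πsel y z v) y v, u - y⟫ := by
      intro u hu
      refine aux_opt Q hQconv (fun u => -chi f r₁ r₂ (πsel u z v) u z v) y _ (ℓ + (r₂ + ℓ) / 2)
        hy (fun u hu => neg_le_neg (hmax' u hu)) (fun u hu => ?_) u hu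
      have := dlow y hy u hu z v
      rw [inner_neg_left]
      linarith
    have hx := (hπsel y z v).1
    have hKmax : ∀ u ∈ Q, chi f r₁ r₂ (πsel y z v) u z v + (r₂ - ℓ) / 2 * ‖u - y‖ ^ 2 ≤
        chi f r₁ r₂ (πsel y z v) y z v := by
      intro u hu
      have h1 := Ky_upper _ hx y hy u hu z v
      have h2 := hopt u hu
      rw [inner_neg_left] at h2
      linarith
    have hcy : ∀ x, ContinuousOn (fun p => chi f r₁ r₂ x p z v) Q := by
      intro x
      have h1 : Continuous (fun y => f x y) :=
        hf.continuous.comp (continuous_const.prodMk continuous_id)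
      unfold chi
      fun_prop
    have hs2 := (hπsel2 z v).1
    have hA := (hπsel2 z v).2 _ hx
    have hB : sSup ((fun p => chi f r₁ r₂ (πsel y z v) p z v) '' Q) ≤
        chi f r₁ r₂ (πsel y z v) y z v := by
      apply csSup_le (hQne.image _)
      rintro _ ⟨u, hu, rfl⟩
      have := hKmax u hu
      have h2 : 0 ≤ (r₂ - ℓ) / 2 * ‖u - y‖ ^ 2 := by positivity
      simp only
      linarith
    have hC : chi f r₁ r₂ (πsel2 z v) y z v ≤
        sSup ((fun p => chi f r₁ r₂ (πsel2 z v) p z v) '' Q) :=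
      le_csSup (hQcpt.bddAbove_image (hcy _)) ⟨y, hy, rfl⟩
    have hD := Kx_lower _ hx _ hs2 y hy z v
    have hE := optx y hy z v _ hs2
    have hxeq : πsel2 z v = πsel y z v := by
      have h1 : (r₁ - L) / 2 * ‖πsel2 z v - πsel y z v‖ ^ 2 ≤ 0 := by linarith
      have h2 : ‖πsel2 z v - πsel y z v‖ ^ 2 ≤ 0 := by
        by_contra h3
        push Not at h3
        have : 0 < (r₁ - L) / 2 * ‖πsel2 z v - πsel y z v‖ ^ 2 := by positivity
        linarith
      have h3 : ‖πsel2 z v - πsel y z v‖ = 0 := by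
        have := le_antisymm h2 (sq_nonneg _)
        exact pow_eq_zero_iff (two_ne_zero) |>.1 this
      exact sub_eq_zero.1 (norm_eq_zero.1 h3)
    have hyeq : pselχ (πsel2 z v) z v = y := by
      have h0 := hpselχ (πsel2 z v) z v
      have h4 := h0.2 y hy
      have h5 := hKmax _ h0.1
      rw [← hxeq] at h5
      have h1 : (r₂ - ℓ) / 2 * ‖pselχ (πsel2 z v) z v - y‖ ^ 2 ≤ 0 := by linarith
      have h2 : ‖pselχ (πsel2 z v) z v - y‖ ^ 2 ≤ 0 := by
        by_contra h3
        push Not at h3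
        have : 0 < (r₂ - ℓ) / 2 * ‖pselχ (πsel2 z v) z v - y‖ ^ 2 := by positivity
        linarith
      have h3 : ‖pselχ (πsel2 z v) z v - y‖ = 0 := by
        have := le_antisymm h2 (sq_nonneg _)
        exact pow_eq_zero_iff (two_ne_zero) |>.1 this
      exact sub_eq_zero.1 (norm_eq_zero.1 h3)
    rw [hφpp, hyeq]
    refine ⟨hxeq, hopt, ?_⟩
    rw [hxeq]
    exact hmax'
  obtain ⟨Y2, hY2⟩ : ∃ Y2 : E₁ → E₂ → E₂, ∀ z v, Y2 z v = pselχ (πsel2 z v) z v :=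
    ⟨_, fun _ _ => rfl⟩
  simp only [← hY2] at saddle
  have hY2Q : ∀ z v, Y2 z v ∈ Q := fun z v => by rw [hY2]; exact (hpselχ _ _ _).1
  have Glip : ∀ y ∈ Q, ∀ y' ∈ Q, ∀ z z' v v',
      ‖gp (πsel y' z' v') y' - gp (πsel y z v) y‖ ≤ ℓ * (2 * ‖y' - y‖ + 2 * ‖z' - z‖) := by
    intro y hy y' hy' z z' v v'
    have h1 := hlipp _ (hπsel y' z' v').1 _ (hπsel y z v).1 y' hy' y hy
    have h2 := xlip y hy y' hy' z z' v v'
    rw [← hℓ] at h1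
    exact h1.trans (mul_le_mul_of_nonneg_left (by linarith) hℓ0.le)
  have ylip : ∀ z z' v v', ‖Y2 z' v' - Y2 z v‖ ≤ 2 * ‖z' - z‖ + 2 * ‖v' - v‖ := by
    intro z z' v v'
    have hy := hY2Q z v
    have hy' := hY2Q z' v'
    have h1 := aux_VI (r₂ - ℓ) (Y2 z v) (Y2 z' v') _ _ _
      (dmono _ hy _ hy' z v) ((saddle z v).2.1 _ hy')
      (by
        have := (saddle z' v').2.1 _ hy
        rw [← neg_sub, inner_neg_right] at this
        exact neg_nonneg.1 this)
    have h2 : -Gy (πsel (Y2 z' v') z v) (Y2 z' v') v - -Gy (πsel (Y2 z' v') z' v') (Y2 z' v') v'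
        = (gp (πsel (Y2 z' v') z' v') (Y2 z' v') - gp (πsel (Y2 z' v') z v) (Y2 z' v'))
          + r₂ • (v' - v) := by
      rw [hGy, hGy]; module
    have h3 := Glip _ hy' _ hy' z z' v v'
    rw [sub_self, norm_zero] at h3
    have h4 := norm_add_le (gp (πsel (Y2 z' v') z' v') (Y2 z' v')
      - gp (πsel (Y2 z' v') z v) (Y2 z' v')) (r₂ • (v' - v))
    rw [norm_smul, Real.norm_of_nonneg hr₂0.le] at h4
    rw [h2] at h1
    have h5 : ℓ * ‖z' - z‖ ≤ (r₂ - ℓ) * ‖z' - z‖ := by gcongr; linarith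
    have h6 : r₂ * ‖v' - v‖ ≤ 2 * (r₂ - ℓ) * ‖v' - v‖ := by gcongr; linarith
    have h7 : (r₂ - ℓ) * ‖Y2 z' v' - Y2 z v‖ ≤ (r₂ - ℓ) * (2 * ‖z' - z‖ + 2 * ‖v' - v‖) := by
      linarith
    exact le_of_mul_le_mul_left h7 hm2
  -- one step
  intro x hx y hy z v xp yp zp vp p0 bp vs hxp hyp hzp hvp hp0 hbp hvs
  rw [← hY2] at hbp
  rw [← hGx] at hxp
  rw [← hGy] at hyp hp0
  have hxpP : xp ∈ P := by rw [hxp]; exact (hprojP _).1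
  have hypQ : yp ∈ Q := by rw [hyp]; exact (hprojQ _).1
  have hp0Q : p0 ∈ Q := by rw [hp0]; exact (hprojQ _).1
  have hxh := (hπsel y z v).1
  have prx : ∀ u ∈ P, ⟪Gx x y z + (1 / τ) • (xp - x), xp - u⟫ ≤ 0 := by
    intro u hu
    have h1 := (hprojP (x - τ • Gx x y z)).2 u hu
    rw [← hxp] at h1
    have h2 : Gx x y z + (1 / τ) • (xp - x) = -((1 / τ) • (x - τ • Gx x y z - xp)) := by
      have h3 : (1 / τ) • (τ • Gx x y z) = Gx x y z := by
        rw [smul_smul, one_div, inv_mul_cancel₀ hτ0.ne', one_smul]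
      rw [smul_sub _ _ xp, smul_sub _ x, h3]; module
    rw [h2, ← neg_sub u xp, inner_neg_neg, real_inner_smul_left]
    exact mul_nonpos_of_nonneg_of_nonpos (by positivity) h1
  have pry : ∀ (G q : E₂), q = projQ (y + σ • G) → ∀ u ∈ Q,
      ⟪-G + (1 / σ) • (q - y), q - u⟫ ≤ 0 := by
    intro G q hq u hu
    have h1 := (hprojQ (y + σ • G)).2 u hu
    rw [← hq] at h1
    have h2 : -G + (1 / σ) • (q - y) = -((1 / σ) • (y + σ • G - q)) := by
      have h3 : (1 / σ) • (σ • G) = G := by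
        rw [smul_smul, one_div, inv_mul_cancel₀ hσ0.ne', one_smul]
      rw [smul_sub _ _ q, smul_add, h3]; module
    rw [h2, ← neg_sub u q, inner_neg_neg, real_inner_smul_left]
    exact mul_nonpos_of_nonneg_of_nonpos (by positivity) h1
  -- bounds on `χ`
  have k1 : chi f r₁ r₂ xp y z v + (1 / τ - (L + r₁) / 2) * ‖xp - x‖ ^ 2 ≤ chi f r₁ r₂ x y z v := by
    have h1 := Kx_upper x hx xp hxpP y hy z v
    have h2 := prx x hx
    rw [inner_add_left, real_inner_smul_left, real_inner_self_eq_norm_sq] at h2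
    linarith
  have k2 := Ky_upper xp hxpP y hy yp hypQ z v
  have k2' : 1 / σ * ‖yp - y‖ ^ 2 ≤ ⟪Gy xp y v, yp - y⟫ := by
    have h2 := pry _ _ hyp y hy
    rw [inner_add_left, real_inner_smul_left, real_inner_self_eq_norm_sq, inner_neg_left] at h2
    linarith
  have k2'' : -(ℓ * ‖xp - πsel y z v‖ * ‖yp - y‖) ≤
      ⟪Gy (πsel y z v) y v, yp - y⟫ - ⟪Gy xp y v, yp - y⟫ := by
    have h3 := real_inner_le_norm (Gy xp y v - Gy (πsel y z v) y v) (yp - y)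
    have h4 : Gy xp y v - Gy (πsel y z v) y v = gp xp y - gp (πsel y z v) y := by
      rw [hGy, hGy]; abel
    have h5 := hlipp _ hxpP _ hxh y hy y hy
    rw [sub_self, norm_zero, add_zero, ← hℓ] at h5
    have h6 : ‖gp xp y - gp (πsel y z v) y‖ * ‖yp - y‖ ≤ ℓ * ‖xp - πsel y z v‖ * ‖yp - y‖ := by
      gcongr
    rw [inner_sub_left, h4] at h3
    linarith
  have hw : ‖z - zp‖ = β * ‖xp - z‖ := by
    rw [hzp, show z - (z + β • (xp - z)) = -(β • (xp - z)) by abel, norm_neg, norm_smul,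
      Real.norm_of_nonneg hβ0.le]
  have hw2 : ‖xp - zp‖ = (1 - β) * ‖xp - z‖ := by
    rw [hzp, show xp - (z + β • (xp - z)) = (1 - β) • (xp - z) by module, norm_smul,
      Real.norm_of_nonneg (by linarith)]
  have hA : ‖vp - v‖ = μ * ‖yp - v‖ := by
    rw [hvp, add_sub_cancel_left, norm_smul, Real.norm_of_nonneg hμ0.le]
  have hA2 : ‖yp - vp‖ = (1 - μ) * ‖yp - v‖ := by
    rw [hvp, show yp - (v + μ • (yp - v)) = (1 - μ) • (yp - v) by module, norm_smul,
      Real.norm_of_nonneg (by linarith)]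
  have k3 : r₁ * (2 - β) / (2 * β) * ‖z - zp‖ ^ 2 = r₁ / 2 * (‖xp - z‖ ^ 2 - ‖xp - zp‖ ^ 2) := by
    rw [hw, hw2]; field_simp; ring
  have k4 : r₂ * (2 - μ) / (2 * μ) * ‖vp - v‖ ^ 2 = r₂ / 2 * (‖yp - v‖ ^ 2 - ‖yp - vp‖ ^ 2) := by
    rw [hA, hA2]; field_simp; ring
  have k5 : chi f r₁ r₂ xp yp zp vp = chi f r₁ r₂ xp yp z v
      - r₁ / 2 * (‖xp - z‖ ^ 2 - ‖xp - zp‖ ^ 2) + r₂ / 2 * (‖yp - v‖ ^ 2 - ‖yp - vp‖ ^ 2) := by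
    unfold chi; ring
  -- bounds on `d`
  have d1 := dlow y hy yp hypQ z v
  have d2 := (hπsel yp z v).2 _ (hπsel yp zp vp).1
  have d3 : chi f r₁ r₂ (πsel yp zp vp) yp zp vp = chi f r₁ r₂ (πsel yp zp vp) yp z v
      - r₁ / 2 * (‖πsel yp zp vp - z‖ ^ 2 - ‖πsel yp zp vp - zp‖ ^ 2)
      + r₂ / 2 * (‖yp - v‖ ^ 2 - ‖yp - vp‖ ^ 2) := by
    unfold chi; ring
  -- bounds on the supremum
  obtain ⟨ys, hys⟩ : ∃ ys, ys = Y2 zp vs := ⟨_, rfl⟩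
  have hysQ : ys ∈ Q := by rw [hys]; exact hY2Q _ _
  have q1 : sSup (Set.range (φpp zp)) ≤ chi f r₁ r₂ (πsel ys zp vs) ys zp vs := by
    have h1 : φpp zp vs = chi f r₁ r₂ (πsel ys zp vs) ys zp vs := by
      rw [hφpp, ← hY2, ← hys, (saddle zp vs).1, ← hys]
    rw [← h1]
    apply csSup_le (Set.range_nonempty _)
    rintro _ ⟨b, rfl⟩
    exact hvs b
  have q2 : chi f r₁ r₂ (πsel ys z vs) ys z vs ≤ sSup (Set.range (φpp z)) :=
    ((saddle z vs).2.2 ys hysQ).trans (le_csSup (hbdd z) ⟨vs, rfl⟩)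
  have q3 := (hπsel ys zp vs).2 _ (hπsel ys z vs).1
  have q4 : chi f r₁ r₂ (πsel ys z vs) ys zp vs = chi f r₁ r₂ (πsel ys z vs) ys z vs
      - r₁ / 2 * (‖πsel ys z vs - z‖ ^ 2 - ‖πsel ys z vs - zp‖ ^ 2) := by
    unfold chi; ring
  have z1 : ‖πsel yp zp vp - zp‖ ^ 2 - ‖πsel yp zp vp - z‖ ^ 2
      + (‖πsel ys z vs - z‖ ^ 2 - ‖πsel ys z vs - zp‖ ^ 2)
      = - (2 * ⟪z - zp, πsel ys z vs - πsel yp zp vp⟫) := by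
    have h1 := aux_sq z (πsel yp zp vp) zp
    have h1' : ∀ u : E₁, ‖u - zp‖ ^ 2 = ‖z - zp‖ ^ 2 + 2 * ⟪z - zp, u - z⟫ + ‖u - z‖ ^ 2 :=
      fun u => aux_sq z u zp
    have h2 : ⟪z - zp, πsel ys z vs - πsel yp zp vp⟫
        = ⟪z - zp, πsel ys z vs - z⟫ - ⟪z - zp, πsel yp zp vp - z⟫ := by
      rw [← inner_sub_right]; congr 1; abel
    rw [h1', h1' (πsel ys z vs), h2]
    ring
  have z2 := real_inner_le_norm (z - zp) (πsel ys z vs - πsel yp zp vp)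
  have z3 : ‖πsel ys z vs - πsel yp zp vp‖ ≤ 2 * ‖z - zp‖ + ‖πsel2 zp vs - πsel2 zp bp‖
      + ‖Y2 zp bp - yp‖ := by
    have h1 := xlip ys hysQ ys hysQ zp z vs vs
    rw [sub_self, norm_zero, zero_add] at h1
    have h2 := xlip yp hypQ (Y2 zp bp) (hY2Q _ _) zp zp vp bp
    rw [sub_self, norm_zero, mul_zero, add_zero] at h2
    have h3 : πsel2 zp vs = πsel ys zp vs := by rw [(saddle zp vs).1, ← hys]
    have h4 := (saddle zp bp).1
    rw [h3, h4]
    have h5 : πsel ys z vs - πsel yp zp vp = (πsel ys z vs - πsel ys zp vs)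
        + (πsel ys zp vs - πsel (Y2 zp bp) zp bp) + (πsel (Y2 zp bp) zp bp - πsel yp zp vp) := by
      abel
    have h6 := norm_add₃_le (a := πsel ys z vs - πsel ys zp vs)
      (b := πsel ys zp vs - πsel (Y2 zp bp) zp bp) (c := πsel (Y2 zp bp) zp bp - πsel yp zp vp)
    rw [← h5] at h6
    linarith
  have z4 : ‖z - zp‖ * ‖πsel ys z vs - πsel yp zp vp‖ ≤ ‖z - zp‖ * (2 * ‖z - zp‖
      + ‖πsel2 zp vs - πsel2 zp bp‖ + ‖Y2 zp bp - yp‖) := by gcongr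
  have z5 : r₁ * (2 * ⟪z - zp, πsel ys z vs - πsel yp zp vp⟫) ≤ 2 * r₁ * ‖z - zp‖ * (2 * ‖z - zp‖
      + ‖πsel2 zp vs - πsel2 zp bp‖ + ‖Y2 zp bp - yp‖) := by
    have := mul_le_mul_of_nonneg_left (z2.trans z4) hr₁0.le
    linarith
  have z6 := congrArg (fun t => r₁ * t) z1
  -- error bounds
  have eX : ‖xp - πsel y z v‖ ≤ κ * ‖xp - x‖ := by
    have h1 := aux_VI (r₁ - L) (πsel y z v) xp _ _ _ (monox _ hxh _ hxpP y hy z)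
      (optx y hy z v _ hxpP) (prx _ hxh)
    have h2 : Gx xp y z - (Gx x y z + (1 / τ) • (xp - x)) =
        (gπ xp y - gπ x y) + (r₁ • (xp - x) - (1 / τ) • (xp - x)) := by
      rw [hGx, hGx]; module
    have h3 := lipx y hy xp hxpP x hx
    have h4 := norm_add_le (gπ xp y - gπ x y) (r₁ • (xp - x) - (1 / τ) • (xp - x))
    have h5 := norm_sub_le (r₁ • (xp - x)) ((1 / τ) • (xp - x))
    rw [norm_smul, norm_smul, Real.norm_of_nonneg hr₁0.le,
      Real.norm_of_nonneg (by positivity : 0 ≤ 1 / τ)] at h5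
    rw [h2] at h1
    have h6 : (r₁ - L) * (κ * ‖xp - x‖) = (2 * r₁ + 1 / τ) * ‖xp - x‖ := by
      rw [hκ]; field_simp
    have h7 : L * ‖xp - x‖ ≤ r₁ * ‖xp - x‖ := by gcongr; linarith
    have h8 : (r₁ - L) * ‖xp - πsel y z v‖ ≤ (r₁ - L) * (κ * ‖xp - x‖) := by
      rw [h6]; linarith
    exact le_of_mul_le_mul_left h8 hm1
  have eg : (r₂ - ℓ) * ‖p0 - Y2 z v‖ ≤ (2 * ℓ + r₂ + 1 / σ) * ‖y - p0‖ := by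
    have h1 := aux_VI (r₂ - ℓ) (Y2 z v) p0 _ _ _ (dmono _ (hY2Q z v) _ hp0Q z v)
      ((saddle z v).2.1 _ hp0Q) (pry _ _ hp0 _ (hY2Q z v))
    have h2 : -Gy (πsel p0 z v) p0 v - (-Gy (πsel y z v) y v + (1 / σ) • (p0 - y)) =
        (gp (πsel y z v) y - gp (πsel p0 z v) p0) + (r₂ • (p0 - y) - (1 / σ) • (p0 - y)) := by
      rw [hGy, hGy]; module
    have h3 := Glip p0 hp0Q y hy z z v v
    rw [sub_self, norm_zero, mul_zero, add_zero] at h3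
    have h4 := norm_add_le (gp (πsel y z v) y - gp (πsel p0 z v) p0)
      (r₂ • (p0 - y) - (1 / σ) • (p0 - y))
    have h5 := norm_sub_le (r₂ • (p0 - y)) ((1 / σ) • (p0 - y))
    rw [norm_smul, norm_smul, Real.norm_of_nonneg hr₂0.le,
      Real.norm_of_nonneg (by positivity : 0 ≤ 1 / σ), norm_sub_rev p0 y] at h5
    rw [h2] at h1
    linarith
  have ee : ‖yp - p0‖ ≤ σ * ℓ * ‖xp - πsel y z v‖ := by
    have a1 := pry _ _ hyp p0 hp0Q
    have a2 := pry _ _ hp0 yp hypQ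
    have h1 := aux_VI (1 / σ) p0 yp (-Gy (πsel y z v) y v + (1 / σ) • (p0 - y))
      (-Gy (πsel y z v) y v + (1 / σ) • (yp - y)) (-Gy xp y v + (1 / σ) • (yp - y))
      (by
        rw [show -Gy (πsel y z v) y v + (1 / σ) • (yp - y)
          - (-Gy (πsel y z v) y v + (1 / σ) • (p0 - y)) = (1 / σ) • (yp - p0) by module,
          real_inner_smul_left, real_inner_self_eq_norm_sq])
      (by
        rw [← neg_sub p0 yp, inner_neg_right]; linarith)
      a1
    have h4 : -Gy (πsel y z v) y v + (1 / σ) • (yp - y) - (-Gy xp y v + (1 / σ) • (yp - y))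
        = gp xp y - gp (πsel y z v) y := by
      rw [hGy, hGy]; module
    have h5 := hlipp _ hxpP _ hxh y hy y hy
    rw [sub_self, norm_zero, add_zero, ← hℓ] at h5
    rw [h4] at h1
    have h6 := mul_le_mul_of_nonneg_left (h1.trans h5) hσ0.le
    rw [← mul_assoc, mul_one_div_cancel hσ0.ne', one_mul] at h6
    linarith
  have eD : ‖yp - Y2 zp v‖ ≤ ‖yp - p0‖ + ‖p0 - Y2 z v‖ + 2 * ‖z - zp‖ := by
    have h1 := ylip zp z v v
    rw [sub_self, norm_zero, mul_zero, add_zero] at h1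
    have h6 := norm_add₃_le (a := yp - p0) (b := p0 - Y2 z v) (c := Y2 z v - Y2 zp v)
    rw [show yp - p0 + (p0 - Y2 z v) + (Y2 z v - Y2 zp v) = yp - Y2 zp v by abel] at h6
    linarith
  have eY : ‖Y2 zp bp - yp‖ ≤ 2 * ‖bp - v‖ + ‖yp - Y2 zp v‖ := by
    have h1 := ylip zp zp v bp
    rw [sub_self, norm_zero, mul_zero, zero_add] at h1
    have h6 := norm_add_le (Y2 zp bp - Y2 zp v) (Y2 zp v - yp)
    rw [sub_add_sub_cancel, norm_sub_rev (Y2 zp v) yp] at h6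
    linarith
  have eB : ‖bp - v‖ ≤ ‖vp - v‖ + μ * ‖yp - Y2 zp v‖ := by
    have h1 : bp - v = (vp - v) - μ • (yp - Y2 zp v) := by
      rw [hbp, hvp]; module
    rw [h1]
    refine (norm_sub_le _ _).trans ?_
    rw [norm_smul, Real.norm_of_nonneg hμ0.le]
  have es : ‖y - p0‖ ≤ ‖yp - y‖ + ‖yp - p0‖ := by
    have h6 := norm_add_le (y - yp) (yp - p0)
    rw [sub_add_sub_cancel, norm_sub_rev y yp] at h6
    exact h6
  have hfinal := aux_num L lam r₁ r₂ τ σ β μ ℓ κ hL hlam hℓ hr₁ hr₂' hτ0 pτ1 pτ2 hσ0 hκ0.le pσ1 pσ2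
    hβ0 pβ1 pβ2 pβ3 hμ0 pμ1 pμ2 ‖xp - x‖ ‖yp - y‖ ‖y - p0‖ ‖z - zp‖ ‖vp - v‖ ‖bp - v‖
    ‖πsel2 zp vs - πsel2 zp bp‖ ‖yp - Y2 zp v‖ ‖yp - p0‖ ‖p0 - Y2 z v‖ ‖xp - πsel y z v‖
    ‖Y2 zp bp - yp‖ (Φ x y z v - Φ xp yp zp vp)
    (norm_nonneg _) (norm_nonneg _) (norm_nonneg _) (norm_nonneg _) (norm_nonneg _)
    (norm_nonneg _) (norm_nonneg _) (norm_nonneg _) (norm_nonneg _) (norm_nonneg _)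
    (norm_nonneg _) (norm_nonneg _)
    (by
      have hpos : 0 ≤ (r₂ - ℓ) / 2 * ‖yp - y‖ ^ 2 := by positivity
      rw [hΦ, hΦ, k3, k4]
      linarith)
    eY eD ee eg eX eB es
  exact hfinal
end
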